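/- Let k > l be even positive integers and let f of weight k and g of weight l be holomorphic Hecke eigenforms on SL2(Z) (normalized, nonzero). Then it cannot happen that for all n, the Hecke eigenvalue of f for T_n equals n^{(k-l)/2} times the eigenvalue of g; equivalently, δ_l^{((k-l)/2)}(g) and f never share all Hecke eigenvalues. -/

import Mathlib

open UpperHalfPlane Complex Finset

noncomputable section

/-- Derivative of a function on the upper half-plane. -/
def dz (f : ℍ → ℂ) (τ : ℍ) : ℂ := deriv (f ∘ ofComplex) τ

/-- Iterated derivative. -/
def dzIter : ℕ → (ℍ → ℂ) → (ℍ → ℂ)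
  | 0 => id
  | (a + 1) => fun f => dz (dzIter a f)

/-- The Maass-Shimura operator of weight `k`. -/
def delta (k : ℤ) (f : ℍ → ℂ) : ℍ → ℂ :=
  fun τ => (1 / (2 * Real.pi * Complex.I)) * ((k / (2 * Complex.I * τ.im)) * f τ + dz f τ)

/-- Iterated Maass-Shimura operator `δ_k^{(r)} = δ_{k+2r-2} ∘ ⋯ ∘ δ_k`. -/
def deltaIter (k : ℤ) : ℕ → (ℍ → ℂ) → (ℍ → ℂ)
  | 0 => id
  | (r + 1) => fun f => delta (k + 2 * r) (deltaIter k r f)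

/-- The `n`-th Hecke operator in weight `k` (level one). -/
def hecke (k : ℤ) (n : ℕ) (f : ℍ → ℂ) : ℍ → ℂ :=
  fun τ => (n : ℂ) ^ (k - 1) * ∑ d ∈ n.divisors, (d : ℂ) ^ (-k) *
    ∑ b ∈ Finset.range d, f (ofComplex ((n * τ + b * d) / (d : ℂ) ^ 2))

/-- The Rankin-Cohen bracket of index `j` of forms of weights `k` and `l`. -/
def RC (k l : ℕ) (j : ℕ) (f g : ℍ → ℂ) : ℍ → ℂ :=
  fun τ => (1 / (2 * Real.pi * Complex.I)) ^ j * ∑ a ∈ Finset.range (j + 1),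
    (-1 : ℂ) ^ a * ((j + k - 1).choose (j - a)) * ((j + l - 1).choose a) *
      dzIter a f τ * dzIter (j - a) g τ

/-- The normalized Eisenstein series of weight `k`, via its `q`-expansion. -/
def E (k : ℕ) : ℍ → ℂ :=
  fun τ => 1 - (2 * k / ((bernoulli k : ℚ) : ℂ)) *
    ∑' n : ℕ, (∑ d ∈ (n + 1).divisors, (d : ℂ) ^ (k - 1)) *
      Complex.exp (2 * Real.pi * Complex.I * (n + 1) * τ)

/-- The discriminant cusp form `Δ = q ∏ (1 - qⁿ)²⁴`. -/
def Disc : ℍ → ℂ :=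
  fun τ => Complex.exp (2 * Real.pi * Complex.I * τ) *
    ∏' n : ℕ, (1 - Complex.exp (2 * Real.pi * Complex.I * τ) ^ (n + 1)) ^ 24

/-- `F` is given on the upper half-plane by the `q`-series with coefficients `c`. -/
def QS (c : ℕ → ℂ) (F : ℂ → ℂ) : Prop :=
  ∀ z : ℂ, 0 < z.im → HasSum (fun m : ℕ => c m * cexp (2 * Real.pi * Complex.I * m * z)) (F z)

lemma norm_qexp (m : ℕ) (z : ℂ) :
    ‖cexp (2 * Real.pi * Complex.I * m * z)‖ = Real.exp (-(2 * Real.pi * m * z.im)) := by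
  rw [Complex.norm_exp]
  congr 1
  simp

lemma QS_deriv {c : ℕ → ℂ} {F : ℂ → ℂ} (h : QS c F) :
    QS (fun m => (2 * Real.pi * Complex.I * m) * c m) (deriv F) ∧
      ∀ z : ℂ, 0 < z.im → DifferentiableAt ℂ F z := by
  have key : ∀ z : ℂ, 0 < z.im →
      HasSum (fun m : ℕ => (2 * Real.pi * Complex.I * m) * c m *
        cexp (2 * Real.pi * Complex.I * m * z)) (deriv F z) ∧ DifferentiableAt ℂ F z := by
    intro z hz
    set V : Set ℂ := {w : ℂ | z.im / 2 < w.im} with hV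
    have hVo : IsOpen V := isOpen_lt continuous_const Complex.continuous_im
    have hzV : z ∈ V := by show z.im / 2 < z.im; linarith
    set u : ℕ → ℝ := fun m => ‖c m‖ * Real.exp (-(2 * Real.pi * m * (z.im / 2))) with hu
    have hus : Summable u := by
      have h1 := (h ((z.im / 2 : ℝ) * Complex.I) (by simpa using hz)).summable.norm
      refine h1.congr fun m => ?_
      rw [norm_mul, norm_qexp]
      simp [hu]
    have hle : ∀ (m : ℕ) (w : ℂ), w ∈ V →
        ‖c m * cexp (2 * Real.pi * Complex.I * m * w)‖ ≤ u m := by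
      intro m w hw
      rw [norm_mul, norm_qexp]
      refine mul_le_mul_of_nonneg_left ?_ (norm_nonneg _)
      apply Real.exp_le_exp.2
      apply neg_le_neg
      have : z.im / 2 ≤ w.im := le_of_lt hw
      have := Real.pi_pos
      gcongr
    have hd : ∀ (m : ℕ) (w : ℂ), HasDerivAt
        (fun w => c m * cexp (2 * Real.pi * Complex.I * m * w))
        ((2 * Real.pi * Complex.I * m) * c m * cexp (2 * Real.pi * Complex.I * m * w)) w := by
      intro m w
      have := (((hasDerivAt_id w).const_mul (2 * Real.pi * Complex.I * m)).cexp).const_mul (c m)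
      convert! this using 1
      simp only [id]
      ring
    have hdo : ∀ m : ℕ, DifferentiableOn ℂ
        (fun w => c m * cexp (2 * Real.pi * Complex.I * m * w)) V :=
      fun m w _ => (hd m w).differentiableAt.differentiableWithinAt
    have hev : F =ᶠ[nhds z] fun w => ∑' m : ℕ, c m * cexp (2 * Real.pi * Complex.I * m * w) := by
      filter_upwards [hVo.mem_nhds hzV] with w hw
      refine (h w ?_).tsum_eq.symm
      have : z.im / 2 < w.im := hw
      linarith
    constructor
    · have := hasSum_deriv_of_summable_norm hus hdo hVo hle hzV
      rw [hev.deriv_eq]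
      refine this.congr_fun fun m => ?_
      exact ((hd m z).deriv).symm
    · have := (differentiableOn_tsum_of_summable_norm hus hdo hVo hle).differentiableAt
        (hVo.mem_nhds hzV)
      exact this.congr_of_eventuallyEq hev
  exact ⟨fun z hz => (key z hz).1, fun z hz => (key z hz).2⟩

lemma QS_iter {c : ℕ → ℂ} {F : ℂ → ℂ} (h : QS c F) (s : ℕ) :
    QS (fun m => (2 * Real.pi * Complex.I * m) ^ s * c m) (deriv^[s] F) := by
  induction s with
  | zero => simpa using h
  | succ s ih =>
    rw [Function.iterate_succ_apply']
    convert (QS_deriv ih).1 using 2 with m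
    ring

lemma QS_hasDerivAt {c : ℕ → ℂ} {F : ℂ → ℂ} (h : QS c F) (s : ℕ) (z : ℂ) (hz : 0 < z.im) :
    HasDerivAt (deriv^[s] F) (deriv^[s + 1] F z) z := by
  rw [Function.iterate_succ_apply']
  exact ((QS_deriv (QS_iter h s)).2 z hz).hasDerivAt

lemma QS_periodic {c : ℕ → ℂ} {F : ℂ → ℂ} (h : QS c F) (z : ℂ) (hz : 0 < z.im) (N : ℕ) :
    F (z + N) = F z := by
  have h1 := h (z + N) (by simpa using hz)
  refine HasSum.unique h1 ?_
  convert! h z hz using 3 with m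
  rw [Complex.exp_eq_exp_iff_exists_int]
  exact ⟨m * N, by push_cast; ring⟩

lemma im_neg_inv {z : ℂ} (hz : 0 < z.im) : 0 < (-1 / z).im := by
  have hz0 : z ≠ 0 := by rintro rfl; simp at hz
  have : 0 < Complex.normSq z := Complex.normSq_pos.2 hz0
  rw [neg_div, one_div, Complex.neg_im, Complex.inv_im]
  rw [neg_div, neg_neg]
  positivity

lemma transform {c : ℕ → ℂ} {G : ℂ → ℂ} (h : QS c G) (l : ℕ) (hl : 0 < l)
    (hG : ∀ z : ℂ, 0 < z.im → G (-1 / z) = z ^ l * G z) (s : ℕ) :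
    ∃ C : ℕ → ℕ, 0 < C 0 ∧ (∀ j, s < j → C j = 0) ∧ ∀ z : ℂ, 0 < z.im →
      deriv^[s] G (-1 / z) =
        ∑ j ∈ Finset.range (s + 1), (C j : ℂ) * z ^ (l + s + j) * deriv^[j] G z := by
  induction s with
  | zero =>
    refine ⟨fun j => if j = 0 then 1 else 0, by simp, fun j hj => if_neg (by omega), ?_⟩
    intro z hz
    simpa using hG z hz
  | succ s ih =>
    obtain ⟨C, hC0, hCs, hC⟩ := ih
    refine ⟨fun j => (l + s + j) * C j + (if j = 0 then 0 else C (j - 1)), ?_, ?_, ?_⟩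
    · simp only [if_true]; positivity
    · intro j hj
      simp only [if_neg (show j ≠ 0 by omega), hCs j (by omega), hCs (j - 1) (by omega)]
      simp
    intro z hz
    have hz0 : z ≠ 0 := by rintro rfl; simp at hz
    have hL : HasDerivAt (fun w => deriv^[s] G (-1 / w))
        (deriv^[s + 1] G (-1 / z) * (1 / z ^ 2)) z := by
      have h1 : HasDerivAt (fun w : ℂ => -1 / w) (1 / z ^ 2) z := by
        have := (hasDerivAt_inv hz0).neg
        convert! this using 1
        · funext w; simp [neg_div]
        · simp
      exact (QS_hasDerivAt h s (-1 / z) (im_neg_inv hz)).comp z h1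
    have hR : HasDerivAt (fun w => ∑ j ∈ Finset.range (s + 1),
          (C j : ℂ) * w ^ (l + s + j) * deriv^[j] G w)
        (∑ j ∈ Finset.range (s + 1), ((C j : ℂ) * ((l + s + j : ℕ) * z ^ (l + s + j - 1))
          * deriv^[j] G z + (C j : ℂ) * z ^ (l + s + j) * deriv^[j + 1] G z)) z := by
      refine HasDerivAt.fun_sum fun j _ => ?_
      exact ((hasDerivAt_pow (l + s + j) z).const_mul (C j : ℂ)).mul (QS_hasDerivAt h j z hz)
    have hev : (fun w => deriv^[s] G (-1 / w)) =ᶠ[nhds z] (fun w => ∑ j ∈ Finset.range (s + 1),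
          (C j : ℂ) * w ^ (l + s + j) * deriv^[j] G w) := by
      filter_upwards [(isOpen_lt continuous_const Complex.continuous_im).mem_nhds hz] with w hw
      exact hC w hw
    have heq := hL.unique (hR.congr_of_eventuallyEq hev)
    have heq2 : deriv^[s + 1] G (-1 / z) = z ^ 2 * (deriv^[s + 1] G (-1 / z) * (1 / z ^ 2)) := by
      field_simp
    rw [heq2, heq, Finset.sum_add_distrib, mul_add]
    have hsplit : ∀ j : ℕ, (((l + s + j) * C j + (if j = 0 then 0 else C (j - 1)) : ℕ) : ℂ)
        * z ^ (l + (s + 1) + j) * deriv^[j] G z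
        = ((l + s + j : ℕ) : ℂ) * C j * z ^ (l + (s + 1) + j) * deriv^[j] G z
        + ((if j = 0 then 0 else C (j - 1) : ℕ) : ℂ) * z ^ (l + (s + 1) + j) * deriv^[j] G z := by
      intro j; push_cast; ring
    simp_rw [hsplit]
    rw [Finset.sum_add_distrib]
    congr 1
    · rw [Finset.sum_range_succ _ (s + 1), hCs (s + 1) (by omega), Finset.mul_sum]
      simp only [Nat.cast_zero, mul_zero, zero_mul, add_zero]
      refine Finset.sum_congr rfl fun j _ => ?_
      obtain ⟨p, hp⟩ : ∃ p, l + s + j = p + 1 := ⟨l + s + j - 1, by omega⟩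
      rw [show l + (s + 1) + j = p + 2 by omega, hp]
      simp only [Nat.add_sub_cancel]
      ring
    · rw [Finset.sum_range_succ' _ (s + 1), Finset.mul_sum]
      simp only [if_true, Nat.cast_zero, zero_mul, add_zero]
      refine Finset.sum_congr rfl fun j _ => ?_
      simp only [Nat.add_sub_cancel, if_neg (Nat.succ_ne_zero j)]
      ring

lemma root_sum (d m : ℕ) (hd : 0 < d) :
    ∑ b ∈ Finset.range d, cexp (2 * Real.pi * Complex.I * m / d) ^ b
      = if d ∣ m then (d : ℂ) else 0 := by
  have hd0 : (d : ℂ) ≠ 0 := by exact_mod_cast hd.ne'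
  have h2 : (2 * Real.pi * Complex.I : ℂ) ≠ 0 := Complex.two_pi_I_ne_zero
  split_ifs with hdm
  · obtain ⟨e, rfl⟩ := hdm
    have : cexp (2 * Real.pi * Complex.I * (d * e : ℕ) / d) = 1 := by
      rw [Complex.exp_eq_one_iff]
      exact ⟨e, by push_cast; field_simp⟩
    rw [this]
    simp
  · have hne : cexp (2 * Real.pi * Complex.I * m / d) ≠ 1 := by
      intro h
      rw [Complex.exp_eq_one_iff] at h
      obtain ⟨e, he⟩ := h
      apply hdm
      have : (m : ℂ) = d * e := by
        field_simp at he
        exact he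
      have h3 : (m : ℤ) = d * e := by exact_mod_cast this
      exact Int.natCast_dvd_natCast.1 ⟨e, h3⟩
    rw [geom_sum_eq hne, ← Complex.exp_nat_mul]
    have : cexp (d * (2 * Real.pi * Complex.I * m / d)) = 1 := by
      rw [Complex.exp_eq_one_iff]
      exact ⟨m, by push_cast; field_simp⟩
    simp [this]

lemma QS_inner {c : ℕ → ℂ} {F : ℂ → ℂ} (h : QS c F) (d e : ℕ) (hd : 0 < d) (he : 0 < e) :
    QS (fun M => if e ∣ M then d * c (d * (M / e)) else 0)
      (fun z => ∑ b ∈ Finset.range d, F (((d * e : ℕ) * z + b * d) / (d : ℂ) ^ 2)) := by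
  intro z hz
  have hd0 : (d : ℂ) ≠ 0 := by exact_mod_cast hd.ne'
  have h1 : HasSum (fun m : ℕ => c m * cexp (2 * Real.pi * Complex.I * m * (e * z / d)) *
      (if d ∣ m then (d : ℂ) else 0))
      (∑ b ∈ Finset.range d, F (((d * e : ℕ) * z + b * d) / (d : ℂ) ^ 2)) := by
    have h2 := hasSum_sum (s := Finset.range d)
      (f := fun (b : ℕ) (m : ℕ) => c m * cexp (2 * Real.pi * Complex.I * m *
        (((d * e : ℕ) * z + b * d) / (d : ℂ) ^ 2)))
      (a := fun (b : ℕ) => F (((d * e : ℕ) * z + b * d) / (d : ℂ) ^ 2)) (fun b _ => h _ (by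
        have : (((d * e : ℕ) * z + b * d) / (d : ℂ) ^ 2) = ((e / d : ℝ) : ℂ) * z + ((b / d : ℝ) : ℂ) := by
          push_cast; field_simp
        rw [this, Complex.add_im, Complex.im_ofReal_mul, Complex.ofReal_im, add_zero]
        positivity))
    convert! h2 using 2 with m
    rw [← root_sum d m hd, Finset.mul_sum]
    refine Finset.sum_congr rfl fun b _ => ?_
    rw [← Complex.exp_nat_mul, mul_assoc, ← Complex.exp_add]
    congr 2
    push_cast
    field_simp
  have i1 : Function.Injective (fun m : ℕ => d * m) := fun a b hab => Nat.eq_of_mul_eq_mul_left hd hab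
  have i2 : Function.Injective (fun m : ℕ => e * m) := fun a b hab => Nat.eq_of_mul_eq_mul_left he hab
  rw [← i1.hasSum_iff] at h1
  · rw [← i2.hasSum_iff]
    · refine h1.congr_fun fun m => ?_
      simp only [Function.comp, dvd_mul_right, if_true, Nat.mul_div_cancel_left _ he]
      have : (2 * Real.pi * Complex.I * (d * m : ℕ) * (e * z / d)) =
          2 * Real.pi * Complex.I * (e * m : ℕ) * z := by
        push_cast; field_simp
      rw [this]; ring
    · intro x hx
      show (if e ∣ x then (d : ℂ) * c (d * (x / e)) else 0) * _ = 0
      rw [if_neg, zero_mul]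
      rintro ⟨y, rfl⟩
      exact hx ⟨y, rfl⟩
  · intro x hx
    rw [if_neg, mul_zero]
    rintro ⟨y, rfl⟩
    exact hx ⟨y, rfl⟩

lemma QS_hecke {c : ℕ → ℂ} {f : ℍ → ℂ} (h : QS c (f ∘ ofComplex)) (k : ℤ) (n : ℕ) (hn : 0 < n) :
    ∃ c' : ℕ → ℂ, c' 1 = c n ∧ QS c' (hecke k n f ∘ ofComplex) := by
  refine ⟨fun M => (n : ℂ) ^ (k - 1) * ∑ d ∈ n.divisors, (d : ℂ) ^ (-k) *
    (if (n / d) ∣ M then d * c (d * (M / (n / d))) else 0), ?_, ?_⟩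
  · have hn0 : (n : ℂ) ≠ 0 := by exact_mod_cast hn.ne'
    simp only
    rw [Finset.sum_eq_single n]
    · rw [Nat.div_self hn, if_pos (dvd_refl 1), Nat.div_self one_pos, mul_one, zpow_sub₀ hn0,
        zpow_neg, zpow_one]
      field_simp
    · intro d hd hdn
      rw [if_neg, mul_zero]
      intro h1
      have h2 := Nat.dvd_one.1 h1
      have h3 := Nat.div_mul_cancel (Nat.dvd_of_mem_divisors hd)
      rw [h2, one_mul] at h3
      exact hdn h3
    · intro hnn
      exact absurd (Nat.mem_divisors_self n hn.ne') hnn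
  · intro z hz
    have hzc : ((ofComplex z : ℍ) : ℂ) = z := by
      rw [ofComplex_apply_of_im_pos hz]
    simp only [Function.comp, hecke, hzc]
    have hs := (hasSum_sum (s := n.divisors)
      (f := fun (d : ℕ) (M : ℕ) => (d : ℂ) ^ (-k) * ((if (n / d) ∣ M then d * c (d * (M / (n / d))) else 0) *
        cexp (2 * Real.pi * Complex.I * M * z)))
      (a := fun (d : ℕ) => (d : ℂ) ^ (-k) *
        ∑ b ∈ Finset.range d, f (ofComplex ((n * z + b * d) / (d : ℂ) ^ 2))) (fun d hd => by
        have hdn := Nat.dvd_of_mem_divisors hd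
        have hd0 := Nat.pos_of_mem_divisors hd
        have := QS_inner h d (n / d) hd0 (Nat.div_pos (Nat.le_of_dvd hn hdn) hd0) z hz
        rw [Nat.mul_div_cancel' hdn] at this
        exact this.mul_left _)).mul_left ((n : ℂ) ^ (k - 1))
    convert! hs using 2 with M
    rw [mul_assoc, Finset.sum_mul]
    congr 1
    refine Finset.sum_congr rfl fun d _ => ?_
    ring

lemma QS_modular (k : ℤ) (f : ModularForm (CongruenceSubgroup.Gamma 1) k) :
    QS (fun m => (qExpansion 1 f).coeff m) (f ∘ ofComplex) := by
  intro z hz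
  have hp : (1 : ℝ) ∈ ((CongruenceSubgroup.Gamma 1 : Subgroup (Matrix.SpecialLinearGroup (Fin 2) ℤ)) :
    Subgroup (GL (Fin 2) ℝ)).strictPeriods := by simp
  have : Fact (IsCusp OnePoint.infty ((CongruenceSubgroup.Gamma 1 :
      Subgroup (Matrix.SpecialLinearGroup (Fin 2) ℤ)) : Subgroup (GL (Fin 2) ℝ))) :=
    ⟨Subgroup.isCusp_of_mem_strictPeriods one_pos hp⟩
  have := ModularForm.hasSum_qExpansion f one_pos hp (ofComplex z)
  convert! this using 2 with m
  rw [ofComplex_apply_of_im_pos hz, Function.Periodic.qParam, ← Complex.exp_nat_mul]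
  congr 2
  simp
  ring

lemma QS_unique (k : ℤ) (f : ModularForm (CongruenceSubgroup.Gamma 1) k) (c : ℕ → ℂ)
    (h : QS c (f ∘ ofComplex)) (m : ℕ) : c m = (qExpansion 1 f).coeff m := by
  have hp : (1 : ℝ) ∈ ((CongruenceSubgroup.Gamma 1 : Subgroup (Matrix.SpecialLinearGroup (Fin 2) ℤ)) :
    Subgroup (GL (Fin 2) ℝ)).strictPeriods := by simp
  refine ModularFormClass.qExpansion_coeff_unique (f := f) (k := k) one_pos hp (fun τ => ?_) m
  have := h τ τ.im_pos
  simp only [Function.comp, ofComplex_apply] at this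
  convert! this using 2 with m
  rw [smul_eq_mul, Function.Periodic.qParam, ← Complex.exp_nat_mul]
  congr 2
  simp
  ring

lemma coeff_eig (k : ℤ) (f : ModularForm (CongruenceSubgroup.Gamma 1) k) (n : ℕ) (hn : 0 < n)
    (lam : ℂ) (h : hecke k n ⇑f = lam • ⇑f) :
    (qExpansion 1 f).coeff n = lam * (qExpansion 1 f).coeff 1 := by
  obtain ⟨c', h1, h2⟩ := QS_hecke (QS_modular k f) k n hn
  rw [h] at h2
  have h3 : QS (fun m => lam * (qExpansion 1 f).coeff m) ((lam • ⇑f) ∘ ofComplex) := by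
    intro z hz
    refine ((QS_modular k f z hz).mul_left lam).congr_fun fun m => ?_
    ring
  have h4 := QS_unique k (lam • f) c' h2 1
  have h5 := QS_unique k (lam • f) _ h3 1
  rw [← h1, h4, ← h5]

lemma modular_S (k : ℕ) (f : ModularForm (CongruenceSubgroup.Gamma 1) (k : ℤ)) (z : ℂ)
    (hz : 0 < z.im) : (f ∘ ofComplex) (-1 / z) = z ^ k * (f ∘ ofComplex) z := by
  have h := SlashInvariantForm.slash_action_eqn_SL'' f
    (CongruenceSubgroup.mem_Gamma_one ModularGroup.S) ⟨z, hz⟩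
  simp only [Function.comp]
  rw [ofComplex_apply_of_im_pos hz, ofComplex_apply_of_im_pos (im_neg_inv hz)]
  rw [UpperHalfPlane.modular_S_smul, ModularGroup.denom_S, zpow_natCast] at h
  convert! h using 3
  simp [neg_div]

/-- Eigenforms of distinct weights never have eigenvalues related by `n^{(k-l)/2}`. -/
theorem no_shared_eigenvalues (k l : ℤ) (s : ℕ) (hk : Even k) (hl : Even l) (hl0 : 0 < l)
    (hs : 0 < s) (hkl : k = l + 2 * s)
    (f : ModularForm (CongruenceSubgroup.Gamma 1) k)
    (g : ModularForm (CongruenceSubgroup.Gamma 1) l)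
    (hf : ⇑f ≠ 0) (hg : ⇑g ≠ 0) (lamf lamg : ℕ → ℂ)
    (heigf : ∀ n : ℕ, 0 < n → hecke k n ⇑f = lamf n • ⇑f)
    (heigg : ∀ n : ℕ, 0 < n → hecke l n ⇑g = lamg n • ⇑g) :
    ¬ (∀ n : ℕ, 0 < n → lamf n = (n : ℂ) ^ s * lamg n) := by
  intro hrel
  lift l to ℕ using hl0.le
  obtain rfl : k = ((l + 2 * s : ℕ) : ℤ) := by rw [hkl]; push_cast; ring
  have hl1 : 0 < l := by exact_mod_cast hl0
  set a : ℕ → ℂ := fun m => (qExpansion 1 f).coeff m with ha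
  set b : ℕ → ℂ := fun m => (qExpansion 1 g).coeff m with hb
  set F : ℂ → ℂ := f ∘ ofComplex with hF
  set G : ℂ → ℂ := g ∘ ofComplex with hG
  have hqf : QS a F := QS_modular _ f
  have hqg : QS b G := QS_modular _ g
  have hca : ∀ n, 0 < n → a n = lamf n * a 1 := fun n hn => coeff_eig _ f n hn _ (heigf n hn)
  have hcb : ∀ n, 0 < n → b n = lamg n * b 1 := fun n hn => coeff_eig _ g n hn _ (heigg n hn)
  have hSf : ∀ z : ℂ, 0 < z.im → F (-1 / z) = z ^ (l + 2 * s) * F z := modular_S _ f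
  have hSg : ∀ z : ℂ, 0 < z.im → G (-1 / z) = z ^ l * G z := modular_S _ g
  have hroots : ∀ z : ℂ, ∀ P : Polynomial ℂ, (∀ N : ℕ, P.eval (z + N) = 0) → P = 0 := by
    intro z P hP
    refine Polynomial.eq_zero_of_infinite_isRoot P ?_
    refine Set.infinite_of_injective_forall_mem (f := fun N : ℕ => z + N) ?_ hP
    intro m n hmn
    simpa using hmn
  -- a function with only a constant term in its expansion
  have hconst : ∀ (c : ℕ → ℂ) (H : ℂ → ℂ), QS c H → (∀ m, 0 < m → c m = 0) →
      ∀ z : ℂ, 0 < z.im → H z = c 0 := by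
    intro c H hH hc z hz
    have h1 := hH z hz
    have h2 := hasSum_single (f := fun m : ℕ => c m * cexp (2 * Real.pi * Complex.I * m * z)) 0
      (fun m hm => by simp [hc m (Nat.pos_of_ne_zero hm)])
    have := h1.unique h2
    simpa using this
  -- the first coefficient of `f` is nonzero
  have ha1 : a 1 ≠ 0 := by
    intro h0
    have hFc := hconst a F hqf (fun m hm => by rw [hca m hm, h0, mul_zero])
    have hz : a 0 = 0 := by
      have hP := hroots Complex.I (Polynomial.C (a 0) * Polynomial.X ^ (l + 2 * s)
        - Polynomial.C (a 0)) (fun N => by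
          have him : 0 < (Complex.I + N).im := by simp
          have := hSf _ him
          rw [hFc _ him, hFc _ (im_neg_inv him)] at this
          simp only [Polynomial.eval_sub, Polynomial.eval_mul, Polynomial.eval_C,
            Polynomial.eval_pow, Polynomial.eval_X]
          linear_combination -this)
      have := congrArg (fun P => Polynomial.coeff P 0) hP
      simpa [Polynomial.coeff_X_pow, hl1.ne', Polynomial.coeff_C,
        show ¬ (0 = l + 2 * s) by omega] using this
    apply hf
    funext τ
    have := hFc τ τ.im_pos
    simpa [hF, hz] using this
  obtain ⟨C, hC0, -, hC⟩ := transform hqg l hl1 hSg s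
  set K : ℂ := (2 * Real.pi * Complex.I) ^ s with hK
  have hlin : ∃ e : ℂ, ∀ z : ℂ, 0 < z.im → K * b 1 * F z = a 1 * deriv^[s] G z + e := by
    have hq : QS (fun m => K * b 1 * a m - a 1 * ((2 * Real.pi * Complex.I * m) ^ s * b m))
        (fun z => K * b 1 * F z - a 1 * deriv^[s] G z) := by
      intro z hz
      convert! ((hqf z hz).mul_left (K * b 1)).sub ((QS_iter hqg s z hz).mul_left (a 1)) using 2
      ring
    have := hconst _ _ hq (fun m hm => by
      rw [hca m hm, hcb m hm, hrel m hm, mul_pow _ (m : ℂ)]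
      ring)
    refine ⟨K * b 1 * a 0 - a 1 * ((2 * Real.pi * Complex.I * (0 : ℕ)) ^ s * b 0), fun z hz => ?_⟩
    rw [← this z hz]
    ring
  obtain ⟨e, he⟩ := hlin
  apply hg
  funext τ
  have hτ := τ.im_pos
  have hP := hroots τ (Polynomial.C (K * b 1 * F τ) * Polynomial.X ^ (l + 2 * s)
    - Polynomial.C (a 1) * ∑ j ∈ Finset.range (s + 1),
      Polynomial.C ((C j : ℂ) * deriv^[j] G τ) * Polynomial.X ^ (l + s + j)
    - Polynomial.C e) (fun N => by
      have him : 0 < ((τ : ℂ) + N).im := by simpa using hτ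
      have h1 := he _ (im_neg_inv him)
      rw [hSf _ him, hC _ him, QS_periodic hqf _ hτ] at h1
      simp only [Polynomial.eval_sub, Polynomial.eval_mul, Polynomial.eval_C,
        Polynomial.eval_pow, Polynomial.eval_X, Polynomial.eval_finsetSum]
      have h2 : ∑ j ∈ Finset.range (s + 1), (C j : ℂ) * deriv^[j] G τ * ((τ : ℂ) + N) ^ (l + s + j)
          = ∑ j ∈ Finset.range (s + 1), (C j : ℂ) * ((τ : ℂ) + N) ^ (l + s + j)
            * deriv^[j] G (τ + N) := by
        refine Finset.sum_congr rfl fun j _ => ?_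
        rw [QS_periodic (QS_iter hqg j) _ hτ]
        ring
      rw [h2]
      linear_combination h1)
  have hco := congrArg (fun P => Polynomial.coeff P (l + s)) hP
  simp only [Polynomial.coeff_sub, Polynomial.coeff_C_mul, Polynomial.finsetSum_coeff,
    Polynomial.coeff_X_pow, Polynomial.coeff_C, Polynomial.coeff_zero,
    if_neg (show ¬ (l + s = l + 2 * s) by omega), if_neg (show ¬ (l + s = 0) by omega)] at hco
  rw [Finset.sum_eq_single 0 (fun j _ hj => by rw [if_neg (by omega), mul_zero])
    (fun h => absurd (Finset.mem_range.2 (Nat.succ_pos s)) h)] at hco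
  have hCC : (C 0 : ℂ) ≠ 0 := by exact_mod_cast hC0.ne'
  simp [ha1, hCC] at hco
  simpa [hG] using hco

end
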